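/- There exists n₀ ∈ ℕ such that for all n ≥ n₀ the following holds. Let K ≥ 2 and set k = 2K; assume k is a power of two and k ≤ log₂ n. Then every permutation g of Z₂ⁿ that is a product of K pairwise disjoint transpositions can be realized by a reversible circuit with n inputs (no additional inputs), consisting of gates from Ωₙ², whose gate complexity is at most 12n + k·2^{k+1} + 32·k·log₂ k − 10·log₂ k. -/

import Mathlib

namespace RevCirc

/-- A reversible gate on `n` wires: a target coordinate together with a set of
at most two control coordinates not containing the target.  With no controls it
is a NOT gate, with one control a CNOT gate and with two controls a 2-CNOT
(Toffoli) gate. -/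
abbrev Gate (n : ℕ) : Type :=
  {p : Fin n × Finset (Fin n) // p.2.card ≤ 2 ∧ p.1 ∉ p.2}

def Gate.target {n : ℕ} (g : Gate n) : Fin n := g.1.1

def Gate.controls {n : ℕ} (g : Gate n) : Finset (Fin n) := g.1.2

/-- The transformation of `ℤ₂ⁿ` defined by a gate: the target coordinate is
XOR-ed with the conjunction of the control coordinates. -/
def Gate.apply {n : ℕ} (g : Gate n) (x : Fin n → Bool) : Fin n → Bool :=
  fun i => if i = g.target then xor (x i) (decide (∀ j ∈ g.controls, x j = true)) else x i

/-- The transformation defined by a circuit (a list of gates, applied left to right). -/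
def evalCircuit {n : ℕ} (c : List (Gate n)) (x : Fin n → Bool) : Fin n → Bool :=
  c.foldl (fun y g => g.apply y) x

/-- A circuit realizes a permutation `h` of `ℤ₂ⁿ` (without additional inputs) if the
composition of its gates equals `h`. -/
def realizes {n : ℕ} (c : List (Gate n)) (h : Equiv.Perm (Fin n → Bool)) : Prop :=
  ∀ x, evalCircuit c x = h x

/-- The expanding function `ℤ₂ⁿ → ℤ₂^{n+q}` padding with zeros. -/
def expand (n q : ℕ) (x : Fin n → Bool) : Fin (n + q) → Bool :=
  fun i => if h : (i : ℕ) < n then x ⟨i, h⟩ else false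

/-- A circuit with `n+q` inputs implements `f : ℤ₂ⁿ → ℤ₂ⁿ` using `q` additional
inputs if for some permutation `π` of the wires, the coordinates `π(1),…,π(n)` of the
output on the zero-padded input give `f`. -/
def implements (n q : ℕ) (c : List (Gate (n + q)))
    (f : (Fin n → Bool) → (Fin n → Bool)) : Prop :=
  ∃ π : Equiv.Perm (Fin (n + q)), ∀ x : Fin n → Bool, ∀ i : Fin n,
    evalCircuit c (expand n q x) (π (Fin.castLE (Nat.le_add_right n q) i)) = f x i

/-- `F(n,q)`: the set of transformations `ℤ₂ⁿ → ℤ₂ⁿ` implementable by reversible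
circuits with `n+q` inputs. -/
def FSet (n q : ℕ) : Set ((Fin n → Bool) → (Fin n → Bool)) :=
  {f | ∃ c : List (Gate (n + q)), implements n q c f}

/-- The set of wires touched by a gate: its target together with its controls. -/
def Gate.support {n : ℕ} (g : Gate n) : Finset (Fin n) := insert g.target g.controls

/-- A circuit has depth 1 if the supports of its gates are pairwise disjoint. -/
def DepthOne {n : ℕ} (c : List (Gate n)) : Prop :=
  c.Pairwise fun g₁ g₂ => Disjoint g₁.support g₂.support

/-- The depth of a circuit: the minimal number of consecutive depth-1 sub-circuits
into which it can be divided. -/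
noncomputable def depth {n : ℕ} (c : List (Gate n)) : ℕ :=
  sInf {d | ∃ parts : List (List (Gate n)),
    parts.flatten = c ∧ (∀ p ∈ parts, DepthOne p) ∧ parts.length = d}

/-- The quantum weight of a circuit: each NOT and CNOT gate weighs `WC`, each
2-CNOT gate weighs `WT`. -/
def weight {n : ℕ} (WC WT : ℝ) (c : List (Gate n)) : ℝ :=
  (c.map fun g => if g.controls.card = 2 then WT else WC).sum

/-- `L(f,q)`: minimal gate complexity of a circuit implementing `f` with `q`
additional inputs. -/
noncomputable def Lmin (n q : ℕ) (f : (Fin n → Bool) → (Fin n → Bool)) : ℕ :=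
  sInf {l | ∃ c : List (Gate (n + q)), implements n q c f ∧ c.length = l}

/-- The Shannon gate complexity function `L(n,q)`. -/
noncomputable def ShannonL (n q : ℕ) : ℕ := sSup (Lmin n q '' FSet n q)

/-- `D(f,q)`: minimal depth of a circuit implementing `f` with `q` additional inputs. -/
noncomputable def Dmin (n q : ℕ) (f : (Fin n → Bool) → (Fin n → Bool)) : ℕ :=
  sInf {d | ∃ c : List (Gate (n + q)), implements n q c f ∧ depth c = d}

/-- The Shannon depth function `D(n,q)`. -/
noncomputable def ShannonD (n q : ℕ) : ℕ := sSup (Dmin n q '' FSet n q)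

/-- `W(f,q)`: minimal quantum weight of a circuit implementing `f` with `q`
additional inputs. -/
noncomputable def Wmin (WC WT : ℝ) (n q : ℕ) (f : (Fin n → Bool) → (Fin n → Bool)) : ℝ :=
  sInf {w | ∃ c : List (Gate (n + q)), implements n q c f ∧ weight WC WT c = w}

/-- The Shannon quantum weight function `W(n,q)`. -/
noncomputable def ShannonW (WC WT : ℝ) (n q : ℕ) : ℝ := sSup (Wmin WC WT n q '' FSet n q)

/-- A permutation is a product of `K` pairwise disjoint (independent) transpositions:
there are `2K` pairwise distinct points `x i, y i` with `g = (x 1, y 1)∘⋯∘(x K, y K)`. -/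
def IsProdOfDisjointTranspositions {X : Type*} [DecidableEq X] (K : ℕ)
    (g : Equiv.Perm X) : Prop :=
  ∃ x y : Fin K → X,
    Function.Injective (Sum.elim x y) ∧
    g = ((List.finRange K).map fun i => Equiv.swap (x i) (y i)).prod

end RevCirc


namespace RevCirc

variable {n : ℕ}

theorem eval_append (c d : List (Gate n)) (x : Fin n → Bool) :
    evalCircuit (c ++ d) x = evalCircuit d (evalCircuit c x) := by
  simp [evalCircuit]

theorem eval_nil (x : Fin n → Bool) : evalCircuit [] x = x := rfl

theorem eval_single (g : Gate n) (x : Fin n → Bool) : evalCircuit [g] x = g.apply x := rfl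

theorem gate_invol (g : Gate n) (x : Fin n → Bool) : g.apply (g.apply x) = x := by
  have hg : g.target ∉ g.controls := g.2.2
  have h : ∀ j ∈ g.controls, g.apply x j = x j := by
    intro j hj
    have : j ≠ g.target := fun h => hg (h ▸ hj)
    simp [Gate.apply, this]
  have h2 : (∀ j ∈ g.controls, g.apply x j = true) ↔ (∀ j ∈ g.controls, x j = true) :=
    forall₂_congr fun j hj => by rw [h j hj]
  funext i
  change (if i = g.target then xor (g.apply x i)
    (decide (∀ j ∈ g.controls, g.apply x j = true)) else g.apply x i) = x i
  split_ifs with hi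
  · simp only [h2]
    simp [Gate.apply, hi]
  · simp [Gate.apply, hi]

theorem eval_reverse (c : List (Gate n)) (x : Fin n → Bool) :
    evalCircuit c.reverse (evalCircuit c x) = x := by
  induction c generalizing x with
  | nil => rfl
  | cons g c ih =>
    have : g :: c = [g] ++ c := rfl
    rw [this, eval_append, List.reverse_append, eval_append, ih]
    exact gate_invol g x

theorem eval_inj (c : List (Gate n)) : Function.Injective (evalCircuit c) :=
  Function.LeftInverse.injective (eval_reverse c)

/-- multiply controlled NOT -/
def mct (C : Finset (Fin n)) (t : Fin n) (x : Fin n → Bool) : Fin n → Bool :=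
  fun i => if i = t then xor (x i) (decide (∀ j ∈ C, x j = true)) else x i

theorem exists_gate (C : Finset (Fin n)) (t : Fin n) (hC : C.card ≤ 2) (ht : t ∉ C) :
    ∃ c : List (Gate n), c.length = 1 ∧ ∀ x, evalCircuit c x = mct C t x :=
  ⟨[⟨(t, C), hC, ht⟩], rfl, fun _ => rfl⟩

/-- negate all coordinates of a set -/
theorem exists_not (S : Finset (Fin n)) : ∃ c : List (Gate n), c.length ≤ S.card ∧
    ∀ x, evalCircuit c x = fun j => if j ∈ S then !(x j) else x j := by
  induction S using Finset.induction_on with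
  | empty => exact ⟨[], by simp, fun x => by simp [eval_nil]⟩
  | insert a S ha ih =>
    obtain ⟨c, hc, h⟩ := ih
    obtain ⟨d, hd, h'⟩ := exists_gate (n := n) ∅ a (by simp) (by simp)
    refine ⟨c ++ d, by simp [Finset.card_insert_of_notMem ha]; omega, fun x => ?_⟩
    rw [eval_append, h, h']
    funext j
    by_cases hj : j = a
    · subst hj; simp [mct, ha]
    · simp [mct, hj]

def bz (b : Bool) : ZMod 2 := if b then 1 else 0

theorem bz_inj : Function.Injective bz := by unfold Function.Injective; decide

def xs (S : Finset (Fin n)) (x : Fin n → Bool) : Bool := decide (∑ i ∈ S, bz (x i) = 1)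

theorem bz_xs (S : Finset (Fin n)) (x : Fin n → Bool) : bz (xs S x) = ∑ i ∈ S, bz (x i) := by
  unfold xs
  generalize (∑ i ∈ S, bz (x i)) = z
  revert z; decide

theorem bz_xor : ∀ a b : Bool, bz (xor a b) = bz a + bz b := by decide

theorem xs_insert {S : Finset (Fin n)} {a : Fin n} (ha : a ∉ S) (x : Fin n → Bool) :
    xs (insert a S) x = xor (x a) (xs S x) := by
  apply bz_inj
  rw [bz_xor, bz_xs, bz_xs, Finset.sum_insert ha]

theorem xs_congr {S : Finset (Fin n)} {x y : Fin n → Bool} (h : ∀ i ∈ S, x i = y i) :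
    xs S x = xs S y := by
  apply bz_inj
  rw [bz_xs, bz_xs]
  exact Finset.sum_congr rfl fun i hi => by rw [h i hi]

theorem xs_empty (x : Fin n → Bool) : xs ∅ x = false := by simp [xs]

theorem xs_single (a : Fin n) (x : Fin n → Bool) : xs {a} x = x a := by
  apply bz_inj; rw [bz_xs]; simp

theorem exists_add (S : Finset (Fin n)) (j : Fin n) (hj : j ∉ S) :
    ∃ c : List (Gate n), c.length ≤ S.card ∧
    ∀ x, evalCircuit c x = fun i => if i = j then xor (x i) (xs S x) else x i := by
  induction S using Finset.induction_on with
  | empty => exact ⟨[], by simp, fun x => by simp [eval_nil, xs_empty]⟩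
  | insert a S ha ih =>
    simp only [Finset.mem_insert, not_or] at hj
    obtain ⟨c, hc, h⟩ := ih hj.2
    obtain ⟨d, hd, h'⟩ := exists_gate (n := n) {a} j (by simp) (by simpa using hj.1)
    refine ⟨c ++ d, by simp [Finset.card_insert_of_notMem ha]; omega, fun x => ?_⟩
    rw [eval_append, h, h']
    funext i
    have : a ≠ j := fun h => hj.1 h.symm
    by_cases hi : i = j
    · subst hi
      simp [mct, xs_insert ha, this, Bool.xor_comm, Bool.xor_left_comm]
    · simp [mct, hi]

theorem exists_madd (S : Fin n → Finset (Fin n)) (J : Finset (Fin n))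
    (hJ : ∀ j ∈ J, Disjoint (S j) J) :
    ∃ c : List (Gate n), c.length ≤ ∑ j ∈ J, (S j).card ∧
    ∀ x, evalCircuit c x = fun i => if i ∈ J then xor (x i) (xs (S i) x) else x i := by
  induction J using Finset.induction_on with
  | empty => exact ⟨[], by simp, fun x => by simp [eval_nil]⟩
  | insert a J ha ih =>
    obtain ⟨c, hc, h⟩ := ih fun j hj =>
      (hJ j (Finset.mem_insert_of_mem hj)).mono_right (Finset.subset_insert _ _)
    have hd0 := hJ a (Finset.mem_insert_self _ _)
    have haS : a ∉ S a := fun h => Finset.disjoint_left.mp hd0 h (Finset.mem_insert_self _ _)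
    obtain ⟨d, hd, h'⟩ := exists_add (S a) a haS
    refine ⟨c ++ d, by rw [Finset.sum_insert ha, List.length_append]; omega, fun x => ?_⟩
    rw [eval_append, h, h']
    have hx : xs (S a) (fun i => if i ∈ J then xor (x i) (xs (S i) x) else x i) = xs (S a) x := by
      apply xs_congr
      intro i hi
      have : i ∉ J := fun h => Finset.disjoint_left.mp hd0 hi (Finset.mem_insert_of_mem h)
      simp [this]
    funext i
    rw [hx]
    by_cases hi : i = a
    · subst hi; simp [ha]
    · simp [hi]

/-- conjunction of the first `i` controls -/
def andc (c : ℕ → Fin n) : ℕ → (Fin n → Bool) → Bool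
  | 0, _ => true
  | i + 1, x => x (c (i+1)) && andc c i x

theorem andc_succ (c : ℕ → Fin n) (i : ℕ) (x : Fin n → Bool) :
    andc c (i+1) x = (x (c (i+1)) && andc c i x) := rfl

theorem andc_iff (c : ℕ → Fin n) (i : ℕ) (x : Fin n → Bool) :
    andc c i x = true ↔ ∀ j ∈ Finset.Icc 1 i, x (c j) = true := by
  induction i with
  | zero => simp [andc]
  | succ i ih =>
  rw [andc_succ, Bool.and_eq_true, ih]
  symm
  constructor
  · intro H
    exact ⟨H _ (by simp), fun j hj => H j (by simp at hj ⊢; omega)⟩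
  · rintro ⟨H1, H2⟩ j hj
    simp at hj
    by_cases hj2 : j = i + 1
    · rw [hj2]; exact H1
    · exact H2 j (by simp; omega)

theorem andc_congr {c : ℕ → Fin n} {i : ℕ} {x y : Fin n → Bool}
    (h : ∀ j ∈ Finset.Icc 1 i, x (c j) = y (c j)) : andc c i x = andc c i y := by
  rw [Bool.eq_iff_iff, andc_iff, andc_iff]
  exact forall₂_congr fun j hj => by rw [h j hj]

/-- Toffoli ladder. -/
theorem exists_ladder (c d : ℕ → Fin n) (r : ℕ)
    (hc : ∀ i ∈ Finset.Icc 1 (r+1), ∀ j ∈ Finset.Icc 0 (r+1), c i ≠ d j)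
    (hd : ∀ i ∈ Finset.Icc 0 (r+1), ∀ j ∈ Finset.Icc 0 (r+1), d i = d j → i = j) :
    ∃ l : List (Gate n), l.length ≤ 2 * r + 1 ∧ ∀ x : Fin n → Bool,
      (∀ i ∈ Finset.Icc 1 (r+1), evalCircuit l x (d i) =
        xor (x (d i)) (x (d 0) && andc c i x)) ∧
      (∀ v, (∀ i ∈ Finset.Icc 1 (r+1), v ≠ d i) → evalCircuit l x v = x v) := by
  induction r with
  | zero =>
    have h1 : c 1 ≠ d 1 := hc 1 (by simp) 1 (by simp)
    have h0 : d 0 ≠ d 1 := fun h => by simpa using hd 0 (by simp) 1 (by simp) h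
    obtain ⟨l, hl, h⟩ := exists_gate (n := n) {c 1, d 0} (d 1) Finset.card_le_two
      (by simp [h1.symm, h0.symm])
    refine ⟨l, by omega, fun x => ⟨?_, ?_⟩⟩
    · intro i hi
      have : i = 1 := by simp at hi; omega
      subst this
      rw [h]
      simp [mct, Bool.decide_and, Bool.and_comm, andc]
    · intro v hv
      have := hv 1 (by simp)
      rw [h]; simp [mct, this]
  | succ r ih =>
    obtain ⟨l, hl, h⟩ := ih
      (fun i hi j hj => hc i (by simp at hi ⊢; omega) j (by simp at hj ⊢; omega))
      (fun i hi j hj => hd i (by simp at hi ⊢; omega) j (by simp at hj ⊢; omega))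
    have h1 : c (r+2) ≠ d (r+2) := hc _ (by simp) _ (by simp)
    have h2 : d (r+1) ≠ d (r+2) := fun h => by
      simpa using hd (r+1) (by simp) (r+2) (by simp) h
    obtain ⟨g, hg, hg'⟩ := exists_gate (n := n) {c (r+2), d (r+1)} (d (r+2)) Finset.card_le_two
      (by simp [h1.symm, h2.symm])
    refine ⟨g ++ l ++ g, by simp; omega, fun x => ?_⟩
    rw [eval_append, eval_append]
    set y := evalCircuit g x with hy
    set z := evalCircuit l y with hz
    have hyv : ∀ v, v ≠ d (r+2) → y v = x v := fun v hv => by rw [hy, hg']; simp [mct, hv]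
    have hyd : y (d (r+2)) = xor (x (d (r+2))) (x (c (r+2)) && x (d (r+1))) := by
      rw [hy, hg']; simp [mct, Bool.decide_and]
    have hwv : ∀ v, v ≠ d (r+2) → evalCircuit g z v = z v :=
      fun v hv => by rw [hg']; simp [mct, hv]
    have hwd : evalCircuit g z (d (r+2)) = xor (z (d (r+2))) (z (c (r+2)) && z (d (r+1))) := by
      rw [hg']; simp [mct, Bool.decide_and]
    have hdne : ∀ i, i ≤ r+1 → d i ≠ d (r+2) := fun i hi e => by
      have := hd i (by simp; omega) (r+2) (by simp) e
      omega
    have hcne : ∀ i, 1 ≤ i → i ≤ r+2 → ∀ j ≤ r+2, c i ≠ d j := fun i h1 hi j hj =>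
      hc i (by simp; omega) j (by simp; omega)
    have hAnd : ∀ i, i ≤ r + 2 → andc c i y = andc c i x := by
      intro i hi
      apply andc_congr
      intro j hj
      simp at hj
      rw [hyv _ (hcne j hj.1 (by omega) _ le_rfl)]
    have hzd : ∀ i ∈ Finset.Icc 1 (r+1), z (d i) =
        xor (x (d i)) (x (d 0) && andc c i x) := by
      intro i hi
      have := (h y).1 i hi
      simp at hi
      rw [hz, this, hyv _ (hdne i hi.2), hyv _ (hdne 0 (by omega)), hAnd i (by omega)]
    have hzc : z (c (r+2)) = x (c (r+2)) := by
      rw [hz, (h y).2, hyv _ h1]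
      intro i hi
      simp at hi
      exact hcne _ (by omega) (by omega) _ (by omega)
    have hzt : z (d (r+2)) = y (d (r+2)) := by
      apply (h y).2
      intro i hi
      simp at hi
      exact (hdne i hi.2).symm
    constructor
    · intro i hi
      simp at hi
      by_cases hi2 : i = r + 2
      · subst hi2
        rw [hwd, hzt, hyd, hzc, hzd (r+1) (by simp)]
        rw [andc_succ c (r+1) x]
        generalize x (c (r+2)) = A
        generalize x (d (r+1)) = B
        generalize x (d (r+2)) = D
        generalize x (d 0) = E
        generalize andc c (r+1) x = F
        revert A B D E F
        decide
      · rw [hwv _ (hdne i (by omega)), hzd i (by simp; omega)]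
    · intro v hv
      have hv' := hv (r+2) (by simp)
      rw [hwv v hv', hz, (h y).2 v (fun i hi => hv i (by simp at hi ⊢; omega)), hyv v hv']

theorem exists_seq (C : Finset (Fin n)) (a : Fin n) : ∃ c : ℕ → Fin n,
    (∀ i < C.card, c i ∈ C) ∧ (∀ i < C.card, ∀ j < C.card, c i = c j → i = j) ∧
    (∀ v ∈ C, ∃ i < C.card, c i = v) := by
  refine ⟨fun i => if h : i < C.card then C.equivFin.symm ⟨i, h⟩ else a, ?_, ?_, ?_⟩
  · intro i hi; simp [hi]
  · intro i hi j hj h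
    simp only [hi, hj, dif_pos] at h
    have := C.equivFin.symm.injective (Subtype.ext h)
    simpa using this
  · intro v hv
    refine ⟨C.equivFin ⟨v, hv⟩, (C.equivFin ⟨v, hv⟩).2, ?_⟩
    simp

/-- multiply controlled NOT with dirty bits -/
theorem exists_mct (C D : Finset (Fin n)) (t : Fin n) (htC : t ∉ C) (htD : t ∉ D)
    (hCD : Disjoint C D) (h2 : 2 ≤ C.card) (hle : C.card ≤ D.card + 2) :
    ∃ l : List (Gate n), l.length ≤ 4 * C.card ∧ ∀ x, evalCircuit l x = mct C t x := by
  obtain ⟨r, hr⟩ : ∃ r, C.card = r + 2 := ⟨C.card - 2, by omega⟩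
  obtain ⟨c, hcC, hcinj, hcsurj⟩ := exists_seq C t
  obtain ⟨e, heD, heinj, -⟩ := exists_seq D t
  -- d 0 = c 0, d i = e (i-1) for 1 ≤ i ≤ r, d (r+1) = t
  let d : ℕ → Fin n := fun i => if i = 0 then c 0 else if i ≤ r then e (i-1) else t
  have hd0 : d 0 = c 0 := by simp [d]
  have hdt : d (r+1) = t := by simp [d]
  have hdm : ∀ i, 1 ≤ i → i ≤ r → d i = e (i-1) := fun i h1 h2 => by
    have : i ≠ 0 := by omega
    simp [d, this, h2]
  have hce : ∀ i < r+2, ∀ j < r, c i ≠ e j := fun i hi j hj h =>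
    Finset.disjoint_left.mp hCD (hcC i (by omega)) (h ▸ heD j (by omega))
  have hct : ∀ i < r+2, c i ≠ t := fun i hi h => htC (h ▸ hcC i (by omega))
  have het : ∀ i < r, e i ≠ t := fun i hi h => htD (h ▸ heD i (by omega))
  have cases3 : ∀ i ≤ r+1, i = 0 ∨ (1 ≤ i ∧ i ≤ r) ∨ i = r+1 := fun i hi => by omega
  have hc : ∀ i ∈ Finset.Icc 1 (r+1), ∀ j ∈ Finset.Icc 0 (r+1), c i ≠ d j := by
    intro i hi j hj
    simp at hi hj
    rcases cases3 j hj with rfl | ⟨h1, h2⟩ | rfl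
    · rw [hd0]; intro h
      have := hcinj i (by omega) 0 (by omega) h
      omega
    · rw [hdm j h1 h2]; exact hce i (by omega) _ (by omega)
    · rw [hdt]; exact hct i (by omega)
  have hd : ∀ i ∈ Finset.Icc 0 (r+1), ∀ j ∈ Finset.Icc 0 (r+1), d i = d j → i = j := by
    intro i hi j hj h
    simp at hi hj
    rcases cases3 i hi with rfl | ⟨h1, h2⟩ | rfl <;>
      rcases cases3 j hj with rfl | ⟨h3, h4⟩ | rfl
    · rfl
    · rw [hd0, hdm j h3 h4] at h; exact absurd h (hce 0 (by omega) _ (by omega))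
    · rw [hd0, hdt] at h; exact absurd h (hct 0 (by omega))
    · rw [hd0, hdm i h1 h2] at h; exact absurd h.symm (hce 0 (by omega) _ (by omega))
    · rw [hdm i h1 h2, hdm j h3 h4] at h
      have := heinj _ (by omega) _ (by omega) h
      omega
    · rw [hdt, hdm i h1 h2] at h; exact absurd h (het _ (by omega))
    · rw [hd0, hdt] at h; exact absurd h.symm (hct 0 (by omega))
    · rw [hdt, hdm j h3 h4] at h; exact absurd h.symm (het _ (by omega))
    · rfl
  have key : ∀ x : Fin n → Bool, decide (∀ j ∈ C, x j = true) =
      (x (d 0) && andc c (r+1) x) := by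
    intro x
    rw [Bool.eq_iff_iff]
    simp only [decide_eq_true_eq, Bool.and_eq_true, hd0, andc_iff]
    constructor
    · intro H
      exact ⟨H _ (hcC 0 (by omega)), fun j hj => H _ (hcC j (by simp at hj; omega))⟩
    · rintro ⟨H1, H2⟩ v hv
      obtain ⟨i, hi, rfl⟩ := hcsurj v hv
      rcases Nat.eq_zero_or_pos i with rfl | hi0
      · exact H1
      · exact H2 i (by simp; omega)
  obtain ⟨l, hl, h⟩ := exists_ladder c d r hc hd
  rcases Nat.eq_zero_or_pos r with hr0 | hr0
  · refine ⟨l, by omega, fun x => ?_⟩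
    funext v
    subst hr0
    by_cases hv : v = t
    · subst hv
      have := (h x).1 1 (by simp)
      simp only [zero_add] at hdt key
      rw [hdt] at this
      simp only [mct, if_true, key]
      exact this
    · rw [(h x).2]
      · simp [mct, hv]
      · intro i hi
        have : i = 0 + 1 := by simp at hi; omega
        rw [this, hdt]; exact hv
  · obtain ⟨s, rfl⟩ : ∃ s, r = s + 1 := ⟨r - 1, by omega⟩
    obtain ⟨l', hl', h'⟩ := exists_ladder c d s
      (fun i hi j hj => hc i (by simp at hi ⊢; omega) j (by simp at hj ⊢; omega))
      (fun i hi j hj => hd i (by simp at hi ⊢; omega) j (by simp at hj ⊢; omega))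
    refine ⟨l ++ l', by simp; omega, fun x => ?_⟩
    rw [eval_append]
    set y := evalCircuit l x with hy
    have hyc : ∀ j ∈ Finset.Icc 1 (s+2), y (c j) = x (c j) := by
      intro j hj
      exact (h x).2 _ (fun i hi => hc j hj i (by simp at hi ⊢; omega))
    have hy0 : y (d 0) = x (d 0) := by
      apply (h x).2
      intro i hi h0
      have := hd 0 (by simp) i (by simp at hi ⊢; omega) h0
      simp at hi; omega
    funext v
    by_cases hv : ∃ i ∈ Finset.Icc 1 (s+1), v = d i
    · obtain ⟨i, hi, rfl⟩ := hv
      have hi' := hi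
      simp at hi'
      have hne : d i ≠ t := by
        rw [← hdt]; intro h0
        have := hd i (by simp; omega) _ (by simp) h0
        omega
      have e : andc c i y = andc c i x :=
        andc_congr fun j hj => hyc j (by simp at hj ⊢; omega)
      rw [(h' y).1 i hi, e, hy0, hy, (h x).1 i (by simp; omega)]
      simp [mct, hne]
    · push Not at hv
      rw [(h' y).2 v hv]
      by_cases hvt : v = t
      · subst hvt
        have := (h x).1 (s+1+1) (by simp)
        rw [hdt] at this
        rw [hy, this]
        simp [mct, key]
      · rw [hy, (h x).2 v]
        · simp [mct, hvt]
        · intro i hi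
          by_cases h0 : i = s+1+1
          · rw [h0, hdt]; exact hvt
          · exact hv i (by simp at hi ⊢; omega)

end RevCirc

namespace RevCirc

variable {n : ℕ}

/-- big gate with a single dirty bit -/
theorem exists_big (C : Finset (Fin n)) (t d : Fin n) (htC : t ∉ C) (hdC : d ∉ C) (htd : t ≠ d)
    (h4 : 4 ≤ C.card) :
    ∃ l : List (Gate n), l.length ≤ 8 * C.card + 8 ∧ ∀ x, evalCircuit l x = mct C t x := by
  obtain ⟨A, hAC, hA⟩ := Finset.exists_subset_card_eq (s := C) (n := C.card / 2) (by omega)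
  have hB : (C \ A).card = C.card - C.card / 2 := by
    rw [Finset.card_sdiff_of_subset hAC, hA]
  have hdB : d ∉ C \ A := fun h => hdC (Finset.mem_sdiff.mp h).1
  have hdA : d ∉ A := fun h => hdC (hAC h)
  have htA : t ∉ A := fun h => htC (hAC h)
  have htB : t ∉ C \ A := fun h => htC (Finset.mem_sdiff.mp h).1
  have hI : (insert d (C \ A)).card = C.card - C.card / 2 + 1 := by
    rw [Finset.card_insert_of_notMem hdB, hB]
  obtain ⟨l₁, hl₁, h₁⟩ := exists_mct A (C \ A) d hdA hdB Finset.disjoint_sdiff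
    (by omega) (by omega)
  obtain ⟨l₂, hl₂, h₂⟩ := exists_mct (insert d (C \ A)) A t
    (by simp only [Finset.mem_insert, not_or]; exact ⟨htd, htB⟩) htA
    (by rw [Finset.disjoint_insert_left]; exact ⟨hdA, Finset.sdiff_disjoint⟩) (by omega) (by omega)
  refine ⟨l₁ ++ l₂ ++ l₁ ++ l₂, by simp; omega, fun x => ?_⟩
  rw [eval_append, eval_append, eval_append, h₁, h₂, h₁, h₂]
  have e1 : ∀ (y : Fin n → Bool), decide (∀ j ∈ insert d (C \ A), y j = true) =
      (y d && decide (∀ j ∈ C \ A, y j = true)) := by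
    intro y
    rw [Bool.eq_iff_iff]
    simp only [decide_eq_true_eq, Bool.and_eq_true, Finset.forall_mem_insert]
  have e2 : decide (∀ j ∈ C, x j = true) =
      (decide (∀ j ∈ A, x j = true) && decide (∀ j ∈ C \ A, x j = true)) := by
    rw [Bool.eq_iff_iff]
    simp only [decide_eq_true_eq, Bool.and_eq_true]
    constructor
    · intro H
      exact ⟨fun j hj => H j (hAC hj), fun j hj => H j (Finset.mem_sdiff.mp hj).1⟩
    · rintro ⟨H1, H2⟩ j hj
      by_cases h : j ∈ A
      · exact H1 j h
      · exact H2 j (Finset.mem_sdiff.mpr ⟨hj, h⟩)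
  have congrA : ∀ y : Fin n → Bool, (∀ j ∈ C, y j = x j) →
      decide (∀ j ∈ A, y j = true) = decide (∀ j ∈ A, x j = true) := fun y hy =>
    decide_eq_decide.mpr (forall₂_congr fun j hj => by rw [hy j (hAC hj)])
  have congrB : ∀ y : Fin n → Bool, (∀ j ∈ C, y j = x j) →
      decide (∀ j ∈ C \ A, y j = true) = decide (∀ j ∈ C \ A, x j = true) := fun y hy =>
    decide_eq_decide.mpr (forall₂_congr fun j hj => by rw [hy j (Finset.mem_sdiff.mp hj).1])
  have hCd : ∀ j ∈ C, j ≠ d := fun j hj h => hdC (h ▸ hj)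
  have hCt : ∀ j ∈ C, j ≠ t := fun j hj h => htC (h ▸ hj)
  set a := decide (∀ j ∈ A, x j = true) with ha
  set b := decide (∀ j ∈ C \ A, x j = true) with hb
  -- first stage
  set x1 := mct A d x with hx1
  have x1C : ∀ j ∈ C, x1 j = x j := fun j hj => by simp [hx1, mct, hCd j hj]
  have x1d : x1 d = xor (x d) a := by simp [hx1, mct, ha]
  have x1o : ∀ j, j ≠ d → x1 j = x j := fun j hj => by simp [hx1, mct, hj]
  set x2 := mct (insert d (C \ A)) t x1 with hx2
  have x2t : x2 t = xor (x1 t) (x1 d && b) := by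
    rw [hx2]; unfold mct; rw [if_pos rfl, e1, congrB x1 x1C]
  have x2o : ∀ j, j ≠ t → x2 j = x1 j := fun j hj => by simp [hx2, mct, hj]
  have x2C : ∀ j ∈ C, x2 j = x j := fun j hj => by rw [x2o j (hCt j hj), x1C j hj]
  set x3 := mct A d x2 with hx3
  have x3d : x3 d = xor (x2 d) a := by
    rw [hx3]; unfold mct; rw [if_pos rfl, congrA x2 x2C]
  have x3o : ∀ j, j ≠ d → x3 j = x2 j := fun j hj => by simp [hx3, mct, hj]
  have x3C : ∀ j ∈ C, x3 j = x j := fun j hj => by rw [x3o j (hCd j hj), x2C j hj]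
  funext v
  by_cases hv : v = t
  · subst hv
    unfold mct
    rw [if_pos rfl, if_pos rfl, e1, congrB x3 x3C, e2, x3o v htd, x2t, x1o v htd, x3d,
      x2o d htd.symm, x1d]
    generalize x v = p
    generalize x d = q
    generalize a = a'
    generalize b = b'
    revert p q a' b'
    decide
  · unfold mct
    rw [if_neg hv, if_neg hv]
    by_cases hvd : v = d
    · subst hvd
      rw [x3d, x2o _ hv, x1d]; simp
    · rw [x3o v hvd, x2o v hv, x1o v hvd]

/-- swapping two points in the subcube of `B` -/
theorem exists_swap (B : Finset (Fin n)) (hB3 : 3 ≤ B.card) (hBn : 2 * B.card ≤ n)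
    (a b : Fin n → Bool) (ha : ∀ j, j ∉ B → a j = true) (hb : ∀ j, j ∉ B → b j = true)
    (hab : a ≠ b) :
    ∃ l : List (Gate n), l.length ≤ 8 * B.card ∧
      ∀ v, (∀ j, j ∉ B → v j = true) → evalCircuit l v = Equiv.swap a b v := by
  obtain ⟨t, ht⟩ := Function.ne_iff.mp hab
  have htB : t ∈ B := by
    by_contra h
    exact ht (by rw [ha t h, hb t h])
  have hct : (B.erase t).card = B.card - 1 := Finset.card_erase_of_mem htB
  set S1 := (B.erase t).filter (fun j => a j ≠ b j) with hS1
  have htS1 : t ∉ S1 := by simp [hS1]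
  have cS1 : S1.card ≤ (B.erase t).card := Finset.card_filter_le _ _
  obtain ⟨c1, hc1, h1⟩ := exists_madd (n := n) (fun _ => {t}) S1 (by intros; simpa using htS1)
  simp only [xs_single, Finset.card_singleton, Finset.sum_const, smul_eq_mul, mul_one] at h1 hc1
  set a1 := evalCircuit c1 a with ha1
  set b1 := evalCircuit c1 b with hb1
  have hab1 : ∀ j, j ≠ t → a1 j = b1 j := by
    intro j hj
    rw [ha1, hb1, h1, h1]
    by_cases hjS : j ∈ S1
    · simp only [hjS, if_true]
      have h := (Finset.mem_filter.mp hjS).2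
      revert h ht
      generalize a j = p
      generalize b j = q
      generalize a t = r
      generalize b t = s
      revert p q r s
      decide
    · simp only [hjS, if_false]
      by_contra hne
      apply hjS
      refine Finset.mem_filter.mpr ⟨Finset.mem_erase.mpr ⟨hj, ?_⟩, hne⟩
      by_contra h
      exact hne (by rw [ha j h, hb j h])
  set S2 := (B.erase t).filter (fun j => a1 j = false) with hS2
  have htS2 : t ∉ S2 := by simp [hS2]
  have cS2 : S2.card ≤ (B.erase t).card := Finset.card_filter_le _ _
  obtain ⟨c2, hc2, h2⟩ := exists_not S2
  obtain ⟨c3, hc3, h3⟩ := exists_mct (B.erase t) Bᶜ t (by simp) (by simpa using htB)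
    (Finset.disjoint_left.mpr fun j hj h => by
      simp at hj h; exact h hj.2) (by omega)
    (by rw [Finset.card_compl, Fintype.card_fin]; omega)
  have hV : ∀ v : Fin n → Bool, (∀ j, j ∉ B → v j = true) →
      ∀ j, j ∉ B → evalCircuit (c1 ++ c2) v j = true := by
    intro v hv j hj
    have n1 : j ∉ S1 := fun h => hj (Finset.mem_of_mem_erase (Finset.mem_filter.mp h).1)
    have n2 : j ∉ S2 := fun h => hj (Finset.mem_of_mem_erase (Finset.mem_filter.mp h).1)
    rw [eval_append, h2, h1]
    simp [n1, n2, hv j hj]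
  set E := evalCircuit (c1 ++ c2) with hE
  have hEa : ∀ j, j ≠ t → E a j = true := by
    intro j hj
    by_cases hjB : j ∈ B
    · rw [hE, eval_append, h2, ← ha1]
      by_cases hjS : j ∈ S2
      · have := (Finset.mem_filter.mp hjS).2
        simp [hjS, this]
      · simp only [hjS, if_false]
        by_contra h
        exact hjS (Finset.mem_filter.mpr ⟨Finset.mem_erase.mpr ⟨hj, hjB⟩, by simpa using h⟩)
    · exact hV a ha j hjB
  have hEb : ∀ j, j ≠ t → E b j = true := by
    intro j hj
    rw [← hEa j hj, hE, eval_append, eval_append, h2, h2, ← ha1, ← hb1]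
    simp only [hab1 j hj]
  have hEinj : Function.Injective E := eval_inj _
  have hEt : E a t = !(E b t) := by
    by_contra h
    apply hab
    apply hEinj
    funext j
    by_cases hj : j = t
    · subst hj; revert h; cases E a j <;> cases E b j <;> simp
    · rw [hEa j hj, hEb j hj]
  refine ⟨(c1 ++ c2) ++ c3 ++ (c1 ++ c2).reverse, by simp; omega, fun v hv => ?_⟩
  rw [eval_append, eval_append, h3, ← hE]
  have hback : ∀ w u, mct (B.erase t) t (E w) = E u →
      evalCircuit (c1 ++ c2).reverse (mct (B.erase t) t (E w)) = u := by
    intro w u h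
    rw [h]; exact eval_reverse _ _
  by_cases hva : v = a
  · rw [hva, Equiv.swap_apply_left]
    apply hback
    funext j
    by_cases hj : j = t
    · subst hj
      have : ∀ i ∈ B.erase j, E a i = true := fun i hi => hEa i (Finset.ne_of_mem_erase hi)
      unfold mct
      rw [if_pos rfl, decide_eq_true this, hEt]; simp
    · simp [mct, hj, hEa j hj, hEb j hj]
  by_cases hvb : v = b
  · rw [hvb, Equiv.swap_apply_right]
    apply hback
    funext j
    by_cases hj : j = t
    · subst hj
      have : ∀ i ∈ B.erase j, E b i = true := fun i hi => hEb i (Finset.ne_of_mem_erase hi)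
      unfold mct
      rw [if_pos rfl, decide_eq_true this, hEt]; simp
    · simp [mct, hj, hEa j hj, hEb j hj]
  rw [Equiv.swap_apply_of_ne_of_ne hva hvb]
  apply hback
  have hno : ¬ ∀ i ∈ B.erase t, E v i = true := by
    intro H
    have H' : ∀ j, j ≠ t → E v j = true := fun j hj => by
      by_cases hjB : j ∈ B
      · exact H j (Finset.mem_erase.mpr ⟨hj, hjB⟩)
      · exact hV v hv j hjB
    by_cases h : E v t = E a t
    · apply hva; apply hEinj; funext j
      by_cases hj : j = t
      · rw [hj, h]
      · rw [H' j hj, hEa j hj]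
    · apply hvb; apply hEinj; funext j
      by_cases hj : j = t
      · rw [hj]; revert h hEt; cases E v t <;> cases E a t <;> cases E b t <;> simp
      · rw [H' j hj, hEb j hj]
  funext j
  unfold mct
  rw [decide_eq_false hno]; simp

theorem exists_move {ι : Type*} [DecidableEq ι] (B : Finset (Fin n)) (hB3 : 3 ≤ B.card)
    (hBn : 2 * B.card ≤ n)
    (p q : ι → Fin n → Bool) (hp : ∀ i j, j ∉ B → p i j = true) (hq : ∀ i j, j ∉ B → q i j = true)
    (pinj : Function.Injective p) (qinj : Function.Injective q) (s : Finset ι) :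
    ∃ l : List (Gate n), l.length ≤ s.card * (8 * B.card) ∧
      (∀ i ∈ s, evalCircuit l (p i) = q i) ∧
      (∀ v, (∀ j, j ∉ B → v j = true) → ∀ j, j ∉ B → evalCircuit l v j = true) := by
  induction s using Finset.induction_on with
  | empty => exact ⟨[], by simp, by simp, fun v hv => hv⟩
  | insert a s ha ih =>
    obtain ⟨l, hl, h1, h2⟩ := ih
    by_cases hab : evalCircuit l (p a) = q a
    · refine ⟨l, hl.trans (Nat.mul_le_mul_right _ (Finset.card_le_card (Finset.subset_insert _ _))),
        ?_, h2⟩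
      intro i hi
      rcases Finset.mem_insert.mp hi with rfl | hi
      · exact hab
      · exact h1 i hi
    · have hVa := h2 (p a) (hp a)
      obtain ⟨c, hc, h⟩ := exists_swap B hB3 hBn _ _ hVa (hq a) hab
      refine ⟨l ++ c, ?_, ?_, ?_⟩
      · rw [List.length_append, Finset.card_insert_of_notMem ha, Nat.add_mul, one_mul]; omega
      · intro i hi
        rw [eval_append, h _ (h2 _ (hp i))]
        rcases Finset.mem_insert.mp hi with rfl | hi
        · exact Equiv.swap_apply_left _ _
        · have hia : i ≠ a := fun h => ha (h ▸ hi)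
          rw [Equiv.swap_apply_of_ne_of_ne, h1 i hi]
          · exact fun h => hia (pinj (eval_inj l h))
          · rw [h1 i hi]; exact fun h => hia (qinj h)
      · intro v hv
        rw [eval_append, h _ (h2 v hv)]
        rw [Equiv.swap_apply_def]
        split_ifs
        · exact hq a
        · exact hVa
        · exact h2 v hv

end RevCirc

namespace RevCirc

variable {n : ℕ}

theorem exists_basis {ι : Type} [Fintype ι] (p : ι → Fin n → Bool) :
    ∃ B0 : Finset (Fin n), B0.card ≤ Fintype.card ι ∧
      ∀ j, ∃ S ⊆ B0, ∀ i, p i j = xs S (p i) := by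
  let v : Fin n → ι → ZMod 2 := fun j i => bz (p i j)
  obtain ⟨f, hf, hspan, -⟩ := Submodule.exists_fun_fin_finrank_span_eq (ZMod 2) (Set.range v)
  choose b hb using hf
  refine ⟨Finset.univ.image b, ?_, ?_⟩
  · refine Finset.card_image_le.trans ?_
    rw [Finset.card_univ, Fintype.card_fin]
    exact (Submodule.finrank_le _).trans (by simp)
  · intro j
    have h1 : v j ∈ Submodule.span (ZMod 2) (v '' (↑(Finset.univ.image b) : Set (Fin n))) := by
      have : v '' (↑(Finset.univ.image b) : Set (Fin n)) = Set.range f := by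
        ext y
        simp [hb]
      rw [this, hspan]
      exact Submodule.subset_span ⟨j, rfl⟩
    obtain ⟨c, hc⟩ := (Submodule.mem_span_image_finset_iff_exists_fun' (ZMod 2)).mp h1
    refine ⟨(Finset.univ.image b).filter (fun a => c a = 1), Finset.filter_subset _ _, ?_⟩
    intro i
    apply bz_inj
    rw [bz_xs, Finset.sum_filter]
    have := congrFun hc i
    rw [Finset.sum_apply] at this
    change _ = bz (p i j) at this
    rw [← this]
    apply Finset.sum_congr rfl
    intro a _
    simp only [Pi.smul_apply, v, smul_eq_mul]
    generalize c a = z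
    generalize bz (p i a) = w
    revert z w
    decide

theorem exists_stage1 {ι : Type} [Fintype ι] (p : ι → Fin n → Bool) (hn : 0 < n)
    (hk : Fintype.card ι ≤ n) :
    ∃ B : Finset (Fin n), B.card = Fintype.card ι ∧ ∃ l : List (Gate n),
      l.length ≤ n + Fintype.card ι + 2 ^ Fintype.card ι * Fintype.card ι ∧
      ∀ i j, j ∉ B → evalCircuit l (p i) j = true := by
  classical
  have : Nonempty (Fin n) := ⟨⟨0, hn⟩⟩
  obtain ⟨B0, hB0, hspan⟩ := exists_basis p
  choose S hS hxs using hspan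
  obtain ⟨B, hBB, hB⟩ := Finset.exists_superset_card_eq hB0 (by simpa using hk)
  let col : Fin n → ι → Bool := fun j i => p i j
  let rep : Fin n → Fin n := fun j => Function.invFun col (col j)
  have hrep : ∀ j i, p i (rep j) = p i j := fun j i =>
    congrFun (Function.invFun_eq (f := col) ⟨j, rfl⟩) i
  set R := Finset.univ.image rep with hR
  have hRc : R.card ≤ 2 ^ Fintype.card ι := by
    have : R ⊆ Finset.univ.image (Function.invFun col) := by
      intro a ha
      obtain ⟨j, -, rfl⟩ := Finset.mem_image.mp ha
      exact Finset.mem_image_of_mem _ (Finset.mem_univ _)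
    refine (Finset.card_le_card this).trans (Finset.card_image_le.trans ?_)
    simp
  have hrepR : ∀ j, rep j ∈ R := fun j => Finset.mem_image_of_mem _ (Finset.mem_univ _)
  set R' := R ∪ B with hR'
  obtain ⟨c1, l1, h1⟩ := exists_not R'
  obtain ⟨c2, l2, h2⟩ := exists_madd (fun j => {rep j}) R'ᶜ (by
    intro j _
    simp only [Finset.disjoint_singleton_left, Finset.mem_compl, not_not]
    exact Finset.mem_union_left _ (hrepR j))
  obtain ⟨c3, l3, h3⟩ := exists_not B
  obtain ⟨c4, l4, h4⟩ := exists_madd S (R' \ B) (fun j _ =>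
    (Finset.disjoint_sdiff).mono_left ((hS j).trans hBB))
  refine ⟨B, hB, c1 ++ c2 ++ c3 ++ c4, ?_, ?_⟩
  · have e2 : c2.length ≤ n - R'.card := by
      simpa [Finset.card_compl] using l2
    have e1 : R'.card ≤ n := by simpa using Finset.card_le_univ R'
    have e4 : ∑ j ∈ R' \ B, (S j).card ≤ R.card * Fintype.card ι := by
      have : (R' \ B).card ≤ R.card := Finset.card_le_card (by
        intro a ha
        simp [hR'] at ha ⊢
        tauto)
      calc ∑ j ∈ R' \ B, (S j).card ≤ ∑ j ∈ R' \ B, Fintype.card ι :=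
            Finset.sum_le_sum fun j _ => (Finset.card_le_card (hS j)).trans hB0
        _ = (R' \ B).card * Fintype.card ι := by simp
        _ ≤ _ := Nat.mul_le_mul_right _ this
    have e5 := Nat.mul_le_mul_right (Fintype.card ι) hRc
    simp only [List.length_append]
    omega
  · intro i j hj
    rw [eval_append, eval_append, eval_append, h1, h2, h3, h4]
    set x := p i with hx
    simp only [xs_single]
    have hxS : xs (S j) (fun a => if a ∈ B then
        !(if a ∈ R'ᶜ then xor (if a ∈ R' then !x a else x a)
          (if rep a ∈ R' then !x (rep a) else x (rep a)) else if a ∈ R' then !x a else x a)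
        else (if a ∈ R'ᶜ then xor (if a ∈ R' then !x a else x a)
          (if rep a ∈ R' then !x (rep a) else x (rep a)) else if a ∈ R' then !x a else x a))
        = x j := by
      rw [hx, hxs j i]
      apply xs_congr
      intro a ha
      have haB : a ∈ B := hBB (hS j ha)
      have haR : a ∈ R' := Finset.mem_union_right _ haB
      simp [haB, haR]
    rw [hxS]
    have hr : rep j ∈ R' := Finset.mem_union_left _ (hrepR j)
    by_cases hjR : j ∈ R'
    · simp [hj, hjR]
    · have := hrep j i
      simp only [← hx] at this
      simp [hj, hjR, hr, this]

theorem swaps_apply {X : Type*} [DecidableEq X] {I : Type*} (x y : I → X)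
    (hinj : Function.Injective (Sum.elim x y)) (L : List I) (hL : L.Nodup) :
    (∀ i ∈ L, (L.map fun i => Equiv.swap (x i) (y i)).prod (x i) = y i ∧
      (L.map fun i => Equiv.swap (x i) (y i)).prod (y i) = x i) ∧
    (∀ v, (∀ i ∈ L, v ≠ x i ∧ v ≠ y i) →
      (L.map fun i => Equiv.swap (x i) (y i)).prod v = v) := by
  have hxx : ∀ i j, x i = x j → i = j := fun i j h => by
    simpa using hinj (a₁ := Sum.inl i) (a₂ := Sum.inl j) (by simpa using h)
  have hyy : ∀ i j, y i = y j → i = j := fun i j h => by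
    simpa using hinj (a₁ := Sum.inr i) (a₂ := Sum.inr j) (by simpa using h)
  have hxy : ∀ i j, x i ≠ y j := fun i j h => by
    simpa using hinj (a₁ := Sum.inl i) (a₂ := Sum.inr j) (by simpa using h)
  induction L with
  | nil => simp
  | cons a L ih =>
    obtain ⟨haL, hL'⟩ := List.nodup_cons.mp hL
    obtain ⟨ih1, ih2⟩ := ih hL'
    simp only [List.map_cons, List.prod_cons, Equiv.Perm.mul_apply]
    constructor
    · intro i hi
      rcases List.mem_cons.mp hi with rfl | hi
      · rw [ih2 (x i), ih2 (y i)]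
        · simp
        · intro j hj
          exact ⟨(hxy _ _).symm, fun h => haL (hyy _ _ h ▸ hj)⟩
        · intro j hj
          exact ⟨fun h => haL (hxx _ _ h ▸ hj), hxy _ _⟩
      · have hia : i ≠ a := fun h => haL (h ▸ hi)
        rw [(ih1 i hi).1, (ih1 i hi).2]
        exact ⟨Equiv.swap_apply_of_ne_of_ne (hxy _ _).symm (fun h => hia (hyy _ _ h)),
          Equiv.swap_apply_of_ne_of_ne (fun h => hia (hxx _ _ h)) (hxy _ _)⟩
    · intro v hv
      rw [ih2 v (fun i hi => hv i (List.mem_cons_of_mem _ hi))]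
      have := hv a List.mem_cons_self
      exact Equiv.swap_apply_of_ne_of_ne this.1 this.2

theorem exists_target (M : Finset (Fin n)) (t : Fin n) (ht : t ∈ M) (K : ℕ)
    (hK : K = 2 ^ (M.card - 1)) :
    ∃ X Y : Fin K → Fin n → Bool, Function.Injective (Sum.elim X Y) ∧
      (∀ i j, j ∉ M → X i j = true) ∧ (∀ i j, j ∉ M → Y i j = true) ∧
      (∀ i, mct Mᶜ t (X i) = Y i) ∧ (∀ i, mct Mᶜ t (Y i) = X i) ∧
      (∀ v : Fin n → Bool, (∀ j, j ∉ M → v j = true) → ∃ i, v = X i ∨ v = Y i) := by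
  have hcard : Fintype.card (Fin K) = Fintype.card (↥(M.erase t) → Bool) := by
    rw [Fintype.card_fun, Fintype.card_coe, Finset.card_erase_of_mem ht, hK]
    simp
  let e : Fin K ≃ (↥(M.erase t) → Bool) := Fintype.equivOfCardEq hcard
  let Z : Bool → Fin K → Fin n → Bool := fun b i j =>
    if h : j ∈ M.erase t then e i ⟨j, h⟩ else if j = t then b else true
  have Zt : ∀ b i, Z b i t = b := fun b i => by simp [Z]
  have ZM : ∀ b i j, j ∉ M → Z b i j = true := fun b i j hj => by
    have h1 : j ≠ t := fun h => hj (h ▸ ht)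
    simp [Z, hj, h1]
  have Zo : ∀ b b' i j, j ≠ t → Z b i j = Z b' i j := fun b b' i j hj => by
    simp [Z, hj]
  have Zinj : ∀ b b' i i', Z b i = Z b' i' → i = i' := by
    intro b b' i i' h
    apply e.injective
    funext ⟨j, hj⟩
    have := congrFun h j
    simpa only [Z, hj, dif_pos] using this
  have Zm : ∀ b i, mct Mᶜ t (Z b i) = Z (!b) i := by
    intro b i
    have : ∀ j ∈ Mᶜ, Z b i j = true := fun j hj => ZM b i j (by simpa using hj)
    funext j
    unfold mct
    by_cases hj : j = t
    · rw [if_pos hj, decide_eq_true this, hj, Zt, Zt]; simp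
    · rw [if_neg hj]; exact Zo _ _ _ _ hj
  refine ⟨Z false, Z true, ?_, fun i => ZM _ i, fun i => ZM _ i, Zm false, Zm true, ?_⟩
  · rintro (i | i) (j | j) h
    · simp only [Sum.elim_inl] at h; rw [Zinj _ _ _ _ h]
    · simp only [Sum.elim_inl, Sum.elim_inr] at h
      have := congrFun h t
      rw [Zt, Zt] at this; simp at this
    · simp only [Sum.elim_inl, Sum.elim_inr] at h
      have := congrFun h t
      rw [Zt, Zt] at this; simp at this
    · simp only [Sum.elim_inr] at h; rw [Zinj _ _ _ _ h]
  · intro v hv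
    have key : v = Z (v t) (e.symm fun j => v j) := by
      funext j
      by_cases hj : j = t
      · rw [hj, Zt]
      · by_cases hjM : j ∈ M
        · simp [Z, hj, hjM]
        · rw [hv j hjM, ZM _ _ j hjM]
    refine ⟨e.symm fun j => v j, ?_⟩
    cases h : v t
    · left; rw [h] at key; exact key
    · right; rw [h] at key; exact key

theorem main_nat (K k m : ℕ) (hK : 2 ≤ K) (hk : k = 2 * K) (hm : k = 2 ^ m) (hn : 2 ^ k ≤ n)
    (g : Equiv.Perm (Fin n → Bool)) (hg : IsProdOfDisjointTranspositions K g) :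
    ∃ c : List (Gate n), realizes c g ∧
      c.length ≤ 10 * n + k * 2 ^ (k+1) + (16 * k * k + 2 * k + 8) := by
  obtain ⟨x, y, hinj, rfl⟩ := hg
  have hm2 : 2 ≤ m := by
    by_contra h
    have : m = 0 ∨ m = 1 := by omega
    rcases this with rfl | rfl <;> simp at hm <;> omega
  have hmk : m < k := by rw [hm]; exact Nat.lt_two_pow_self
  have h2k : 2 * k + 4 ≤ 2 ^ k := by
    obtain ⟨s, rfl⟩ : ∃ s, k = s + 4 := ⟨k - 4, by omega⟩
    have : s < 2 ^ s := Nat.lt_two_pow_self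
    rw [pow_add]; omega
  have hcard : Fintype.card (Fin K ⊕ Fin K) = k := by simp; omega
  obtain ⟨B, hB, l1, hl1, h1⟩ := exists_stage1 (Sum.elim x y) (by omega) (by omega)
  rw [hcard] at hB hl1
  obtain ⟨M, hMB, hM⟩ := Finset.exists_subset_card_eq (s := B) (n := m) (by omega)
  obtain ⟨t, ht, d, hd, htd⟩ := Finset.one_lt_card.mp (by omega : 1 < M.card)
  have hK' : K = 2 ^ (M.card - 1) := by
    obtain ⟨s, rfl⟩ : ∃ s, m = s + 1 := ⟨m - 1, by omega⟩
    rw [hM, Nat.add_sub_cancel]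
    rw [pow_succ] at hm; omega
  obtain ⟨X, Y, hXY, hX, hY, hmX, hmY, hcube⟩ := exists_target M t ht K hK'
  obtain ⟨l2, hl2, h2, -⟩ := exists_move B (by omega) (by omega)
    (fun i => evalCircuit l1 (Sum.elim x y i)) (Sum.elim X Y) h1
    (by
      rintro (i | i) j hj
      · exact hX i j fun h => hj (hMB h)
      · exact hY i j fun h => hj (hMB h))
    ((eval_inj l1).comp hinj) hXY Finset.univ
  rw [Finset.card_univ, hcard, hB] at hl2
  have hMc : Mᶜ.card = n - m := by rw [Finset.card_compl, Fintype.card_fin, hM]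
  obtain ⟨l3, hl3, h3⟩ := exists_big Mᶜ t d (by simpa using ht) (by simpa using hd) htd (by omega)
  have hEx : ∀ i, evalCircuit (l1 ++ l2) (x i) = X i := fun i => by
    rw [eval_append]; exact h2 (Sum.inl i) (Finset.mem_univ _)
  have hEy : ∀ i, evalCircuit (l1 ++ l2) (y i) = Y i := fun i => by
    rw [eval_append]; exact h2 (Sum.inr i) (Finset.mem_univ _)
  obtain ⟨hs1, hs2⟩ := swaps_apply x y hinj (List.finRange K) (List.nodup_finRange K)
  refine ⟨(l1 ++ l2) ++ l3 ++ (l1 ++ l2).reverse, ?_, ?_⟩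
  · intro v
    rw [eval_append, eval_append, h3]
    by_cases hv : ∃ i, v = x i ∨ v = y i
    · obtain ⟨i, rfl | rfl⟩ := hv
      · rw [(hs1 i (List.mem_finRange i)).1, hEx, hmX, ← hEy, eval_reverse]
      · rw [(hs1 i (List.mem_finRange i)).2, hEy, hmY, ← hEx, eval_reverse]
    · push Not at hv
      rw [hs2 v fun i _ => hv i]
      have hno : ¬ ∀ j ∈ Mᶜ, evalCircuit (l1 ++ l2) v j = true := by
        intro H
        obtain ⟨i, h | h⟩ := hcube _ fun j hj => H j (by simpa using hj)
        · rw [← hEx] at h; exact (hv i).1 (eval_inj _ h)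
        · rw [← hEy] at h; exact (hv i).2 (eval_inj _ h)
      have : mct Mᶜ t (evalCircuit (l1 ++ l2) v) = evalCircuit (l1 ++ l2) v := by
        funext j
        unfold mct
        rw [decide_eq_false hno]; simp
      rw [this, eval_reverse]
  · simp only [List.length_append, List.length_reverse]
    have e : k * 2 ^ (k+1) = 2 * (2 ^ k * k) := by ring
    have e2 : 16 * k * k = 2 * (k * (8 * k)) := by ring
    rw [e, e2]
    omega

end RevCirc

/-- Theorem: for large enough `n`, if `k = 2K` is a power of two with `k ≤ log₂ n`, then
every product of `K` pairwise disjoint transpositions on `ℤ₂ⁿ` is realized by a circuit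
without additional inputs with gate complexity at most
`12n + k·2^{k+1} + 32·k·log₂ k − 10·log₂ k`. -/
theorem gate_complexity_of_K_disjoint_transpositions :
    ∃ n₀ : ℕ, ∀ n : ℕ, n ≥ n₀ → ∀ K k : ℕ, 2 ≤ K → k = 2 * K →
      (∃ m : ℕ, k = 2 ^ m) → (k : ℝ) ≤ Real.logb 2 n →
      ∀ g : Equiv.Perm (Fin n → Bool),
        RevCirc.IsProdOfDisjointTranspositions K g →
        ∃ c : List (RevCirc.Gate n), RevCirc.realizes c g ∧
          (c.length : ℝ) ≤ 12 * n + k * 2 ^ (k + 1) + 32 * k * Real.logb 2 k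
            - 10 * Real.logb 2 k := by
  refine ⟨4000, ?_⟩
  rintro n hn K k hK hk ⟨m, hm⟩ hlog g hg
  have hn0 : (0 : ℝ) < n := by
    have : 0 < n := by omega
    exact_mod_cast this
  have hkn : 2 ^ k ≤ n := by
    have h := (Real.le_logb_iff_rpow_le (by norm_num : (1 : ℝ) < 2) hn0).mp hlog
    rw [Real.rpow_natCast] at h
    exact_mod_cast h
  obtain ⟨c, hc, hlen⟩ := RevCirc.main_nat K k m hK hk hm hkn g hg
  refine ⟨c, hc, ?_⟩
  have hpoly : 16 * k * k + 2 * k + 8 ≤ 2 * n := by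
    by_cases hk15 : k ≤ 15
    · have : k * k ≤ 15 * 15 := Nat.mul_le_mul hk15 hk15
      rw [Nat.mul_assoc]
      omega
    · have key : ∀ s : ℕ, 16 * (s+16) * (s+16) + 2 * (s+16) + 8 ≤ 2 * 2 ^ (s+16) := by
        intro s
        induction s with
        | zero => simp
        | succ s ih =>
          have e : 2 ^ (s + 1 + 16) = 2 * 2 ^ (s + 16) := by ring
          rw [e]
          generalize 2 ^ (s + 16) = P at ih
          ring_nf at ih ⊢
          omega
      have := key (k - 16)
      rw [Nat.sub_add_cancel (by omega)] at this
      generalize 2 ^ k = P at this hkn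
      generalize 16 * k * k = Q at this
      omega
  have hlen2 : c.length ≤ 12 * n + k * 2 ^ (k+1) := by
    generalize k * 2 ^ (k+1) = P at hlen ⊢
    generalize 16 * k * k = Q at hlen hpoly
    omega
  have hlen3 : (c.length : ℝ) ≤ 12 * n + k * 2 ^ (k+1) := by exact_mod_cast hlen2
  have hk1 : (4 : ℝ) ≤ k := by
    have : 4 ≤ k := by omega
    exact_mod_cast this
  have hl0 : 0 ≤ Real.logb 2 k := Real.logb_nonneg (by norm_num) (by linarith)
  have hpos : 0 ≤ (32 * (k : ℝ) - 10) * Real.logb 2 k := mul_nonneg (by linarith) hl0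
  linarith
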